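/- In the preprojective algebra Π(E_6), with z_6 = a_1a_2x_3a_2^*a_1^* − a_2x_3^2a_2^* − x_5x_3x_5 + a_3x_2^2a_3^* − a_4a_3x_2a_3^*a_4^* and z_8 = −a_2x_5x_3x_5a_2^* − x_5x_3^2x_5 − a_3x_5x_2x_5a_3^*, all products of these positive-degree central elements vanish: z_6^2 = 0, z_6·z_8 = 0 and z_8^2 = 0. -/

import Mathlib

/-- Generators of the preprojective algebra of `E₆`: idempotents `e i` for the six
vertices, arrows `a i` and reversed arrows `astar i` for the five edges. -/
inductive E6Gen : Type
  | e : Fin 6 → E6Gen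
  | a : Fin 5 → E6Gen
  | astar : Fin 5 → E6Gen

namespace E6

/-- The trivial-path generators inside the free algebra. -/
noncomputable def E (i : Fin 6) : FreeAlgebra ℂ E6Gen := FreeAlgebra.ι ℂ (E6Gen.e i)

/-- The arrow generators inside the free algebra. -/
noncomputable def A (i : Fin 5) : FreeAlgebra ℂ E6Gen := FreeAlgebra.ι ℂ (E6Gen.a i)

/-- The reversed-arrow generators inside the free algebra. -/
noncomputable def S (i : Fin 5) : FreeAlgebra ℂ E6Gen := FreeAlgebra.ι ℂ (E6Gen.astar i)

/-- Sources of the arrows `a₁ : 1 → 2`, `a₂ : 2 → 3`, `a₃ : 4 → 3`, `a₄ : 5 → 4`,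
`a₅ : 6 → 3` (vertices are `0`-indexed). -/
def src : Fin 5 → Fin 6 := ![0, 1, 3, 4, 5]

/-- Targets of the arrows of the `E₆` quiver (vertices are `0`-indexed). -/
def tgt : Fin 5 → Fin 6 := ![1, 2, 2, 3, 2]

/-- The defining relations of the preprojective algebra `Π(E₆)`. -/
inductive Rel : FreeAlgebra ℂ E6Gen → FreeAlgebra ℂ E6Gen → Prop
  | orth (i j : Fin 6) : Rel (E i * E j) (if i = j then E i else 0)
  | sum_eq_one : Rel (∑ i, E i) 1
  | arrow_left (i : Fin 5) : Rel (E (src i) * A i) (A i)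
  | arrow_right (i : Fin 5) : Rel (A i * E (tgt i)) (A i)
  | star_left (i : Fin 5) : Rel (E (tgt i) * S i) (S i)
  | star_right (i : Fin 5) : Rel (S i * E (src i)) (S i)
  | preproj : Rel (∑ i, (A i * S i - S i * A i)) 0

end E6

/-- The preprojective algebra `Π(E₆)`: the quotient of the free `ℂ`-algebra on the
generators by the two-sided ideal generated by the defining relations. -/
abbrev PiE6 : Type := RingQuot E6.Rel

/-- The arrow `aᵢ` in `Π(E₆)` (`0`-indexed: `pa 0 = a₁`, …, `pa 4 = a₅`). -/
noncomputable def pa (i : Fin 5) : PiE6 := RingQuot.mkAlgHom ℂ E6.Rel (E6.A i)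

/-- The reversed arrow `aᵢ*` in `Π(E₆)` (`0`-indexed). -/
noncomputable def ps (i : Fin 5) : PiE6 := RingQuot.mkAlgHom ℂ E6.Rel (E6.S i)

/-- The element `xᵢ = aᵢ* aᵢ` in `Π(E₆)` (`0`-indexed: `px 0 = x₁`, …, `px 4 = x₅`). -/
noncomputable def px (i : Fin 5) : PiE6 := ps i * pa i

/-- `z₆ = a₁a₂x₃a₂*a₁* − a₂x₃²a₂* − x₅x₃x₅ + a₃x₂²a₃* − a₄a₃x₂a₃*a₄*`. -/
noncomputable def z6 : PiE6 :=
  pa 0 * pa 1 * px 2 * ps 1 * ps 0 - pa 1 * px 2 ^ 2 * ps 1 - px 4 * px 2 * px 4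
    + pa 2 * px 1 ^ 2 * ps 2 - pa 3 * pa 2 * px 1 * ps 2 * ps 3

/-- `z₈ = −a₂x₅x₃x₅a₂* − x₅x₃²x₅ − a₃x₅x₂x₅a₃*`. -/
noncomputable def z8 : PiE6 :=
  -(pa 1 * px 4 * px 2 * px 4 * ps 1) - px 4 * px 2 ^ 2 * px 4
    - pa 2 * px 4 * px 1 * px 4 * ps 2

section Vertex

variable {R : Type*} [Ring R]

theorem sum_mul_sum_eq_zero_of_orthogonal {ι : Type*} [Fintype ι] {e c d : ι → R}
    (he : ∀ i j, i ≠ j → e i * e j = 0) (hc : ∀ i, c i * e i = c i) (hd : ∀ i, e i * d i = d i)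
    (h : ∀ i, c i * d i = 0) : (∑ i, c i) * ∑ i, d i = 0 := by
  rw [Finset.sum_mul_sum]
  refine Finset.sum_eq_zero fun i _ ↦ Finset.sum_eq_zero fun j _ ↦ ?_
  by_cases hij : i = j
  · exact hij ▸ h i
  · rw [← hc i, ← hd j, mul_assoc, ← mul_assoc (e i), he i j hij, zero_mul, mul_zero]

/-- The relations satisfied by the three length-two loops at the trivalent vertex. -/
structure TrivalentRel (x y z : R) : Prop where
  add_eq_zero : x + y + z = 0
  left_cube : x * x * x = 0
  mid_cube : y * y * y = 0
  right_sq : z * z = 0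

namespace TrivalentRel

variable {x y z : R}

theorem swap (h : TrivalentRel x y z) : TrivalentRel y x z :=
  ⟨by rw [add_comm y x, h.add_eq_zero], h.mid_cube, h.left_cube, h.right_sq⟩

theorem right_eq (h : TrivalentRel x y z) : z = -(x + y) :=
  (neg_eq_of_add_eq_zero_right h.add_eq_zero).symm

theorem add_sq (h : TrivalentRel x y z) : (x + y) * (x + y) = 0 := by
  rw [← neg_mul_neg, ← h.right_eq, h.right_sq]

theorem mul_yxxy_mul (h : TrivalentRel x y z) {p q : R} (hp : p * x = 0) (hq : x * q = 0) :
    p * (y * x * x * y) * q = 0 := by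
  linear_combination (norm := noncomm_ring)
    p * (y * x * h.add_sq - y * h.left_cube - h.add_sq * (y * y) + x * h.mid_cube
      + y * h.mid_cube) * q - p * y * x * y * hq + hp * (x * y * y * q)

theorem mul_yyxyy_mul (h : TrivalentRel x y z) {p q : R} (hp : p * x * x = 0)
    (hq : x * x * q = 0) : p * (y * y * x * y * y) * q = 0 := by
  linear_combination (norm := noncomm_ring)
    p * (-(x * y * y * h.add_sq) + h.add_sq * (y * x * y) - h.mid_cube * (x * y)
      + x * h.mid_cube * x + x * h.mid_cube * y - y * h.add_sq * (x * y) + y * h.left_cube * y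
      + y * y * h.add_sq * y - h.mid_cube * (y * y)) * q
    + p * x * y * y * hq - hp * (y * x * y * q)

theorem yyxzyz (h : TrivalentRel x y z) : y * y * x * (z * y * z) = 0 := by
  have hx : x * z = -(y * z) := by
    linear_combination (norm := noncomm_ring) h.add_eq_zero * z - h.right_sq
  calc y * y * x * (z * y * z) = y * y * (x * z) * (y * z) := by noncomm_ring
    _ = -(y * y * y * z * (y * z)) := by rw [hx]; noncomm_ring
    _ = 0 := by rw [h.mid_cube]; simp

theorem zyzxzyz (h : TrivalentRel x y z) : z * y * z * x * (z * y * z) = 0 := by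
  rw [h.right_eq]
  linear_combination (norm := noncomm_ring)
    x * y * h.left_cube * (y * y) + x * y * x * x * h.mid_cube + x * y * h.left_cube * (y * x)
      - x * y * y * h.mid_cube * x + y * y * h.left_cube * (y * x) + y * y * h.left_cube * (y * y)
      + x * y * y * h.add_sq * (y * x) + x * y * y * h.add_sq * (y * y)
      - x * h.mid_cube * (x * y * y) - x * y * y * h.mid_cube * y + h.add_sq * (x * x * y * y * x)
      - h.left_cube * (x * y * y * x) - y * h.left_cube * (y * y * x)
      - x * h.mid_cube * (x * y * x) + y * y * x * x * h.mid_cube + h.mid_cube * (x * x * y * x)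
      + h.mid_cube * (x * x * y * y) + h.mid_cube * (x * y * y * x) + y * y * y * x * h.mid_cube

end TrivalentRel

end Vertex

namespace PiE6

/-! The generic sign rules do not rewrite in `PiE6`: its multiplication and its negation come from
two different paths of instances. -/

protected theorem mul_neg (x y : PiE6) : x * -y = -(x * y) :=
  _root_.mul_neg x y

protected theorem neg_mul (x y : PiE6) : -x * y = -(x * y) :=
  _root_.neg_mul x y

/-- The idempotent of `Π(E₆)` at a vertex. -/
noncomputable def idem (i : Fin 6) : PiE6 := RingQuot.mkAlgHom ℂ E6.Rel (E6.E i)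

theorem idem_mul_idem (i j : Fin 6) : idem i * idem j = if i = j then idem i else 0 := by
  have h := RingQuot.mkAlgHom_rel ℂ (E6.Rel.orth i j)
  rw [map_mul, apply_ite (RingQuot.mkAlgHom ℂ E6.Rel), map_zero] at h
  exact h

theorem idem_mul_pa (i : Fin 5) : idem (E6.src i) * pa i = pa i :=
  (map_mul _ _ _).symm.trans (RingQuot.mkAlgHom_rel ℂ (E6.Rel.arrow_left i))

theorem pa_mul_idem (i : Fin 5) : pa i * idem (E6.tgt i) = pa i :=
  (map_mul _ _ _).symm.trans (RingQuot.mkAlgHom_rel ℂ (E6.Rel.arrow_right i))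

theorem idem_mul_ps (i : Fin 5) : idem (E6.tgt i) * ps i = ps i :=
  (map_mul _ _ _).symm.trans (RingQuot.mkAlgHom_rel ℂ (E6.Rel.star_left i))

theorem ps_mul_idem (i : Fin 5) : ps i * idem (E6.src i) = ps i :=
  (map_mul _ _ _).symm.trans (RingQuot.mkAlgHom_rel ℂ (E6.Rel.star_right i))

theorem idem_mul_pa_eq_ite (i : Fin 6) (j : Fin 5) :
    idem i * pa j = if i = E6.src j then pa j else 0 := by
  rw [← idem_mul_pa j, ← mul_assoc, idem_mul_idem]
  split_ifs with h
  · rw [h]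
  · rw [zero_mul]

theorem idem_mul_ps_eq_ite (i : Fin 6) (j : Fin 5) :
    idem i * ps j = if i = E6.tgt j then ps j else 0 := by
  rw [← idem_mul_ps j, ← mul_assoc, idem_mul_idem]
  split_ifs with h
  · rw [h]
  · rw [zero_mul]

theorem preproj_at (i : Fin 6) :
    ∑ j, ((if i = E6.src j then pa j * ps j else 0) -
      if i = E6.tgt j then ps j * pa j else 0) = 0 := by
  have h : ∑ j, (pa j * ps j - ps j * pa j) = 0 := by
    have hrel := RingQuot.mkAlgHom_rel ℂ E6.Rel.preproj
    simp only [map_sum, map_sub, map_mul, map_zero] at hrel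
    exact hrel
  have h' := congrArg (idem i * ·) h
  simpa only [Finset.mul_sum, mul_sub, ← mul_assoc, idem_mul_pa_eq_ite, idem_mul_ps_eq_ite,
    ite_mul, zero_mul, mul_zero] using h'

theorem pa_zero_mul_ps_zero : pa 0 * ps 0 = 0 := by
  simpa [Fin.sum_univ_succ, E6.src, E6.tgt] using preproj_at 0

theorem pa_one_mul_ps_one : pa 1 * ps 1 = ps 0 * pa 0 := by
  have := preproj_at 1
  simp [Fin.sum_univ_five, E6.src, E6.tgt] at this
  linear_combination (norm := noncomm_ring) this

theorem pa_two_mul_ps_two : pa 2 * ps 2 = ps 3 * pa 3 := by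
  have := preproj_at 3
  simp [Fin.sum_univ_five, E6.src, E6.tgt] at this
  linear_combination (norm := noncomm_ring) this

theorem pa_three_mul_ps_three : pa 3 * ps 3 = 0 := by
  simpa [Fin.sum_univ_five, E6.src, E6.tgt] using preproj_at 4

theorem pa_four_mul_ps_four : pa 4 * ps 4 = 0 := by
  simpa [Fin.sum_univ_five, E6.src, E6.tgt] using preproj_at 5

theorem px_add_px_add_px : px 1 + px 2 + px 4 = 0 := by
  have := preproj_at 2
  simp [Fin.sum_univ_five, E6.src, E6.tgt] at this
  rw [px, px, px]
  linear_combination (norm := noncomm_ring) -this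

theorem trivalentRel_px : TrivalentRel (px 1) (px 2) (px 4) where
  add_eq_zero := px_add_px_add_px
  left_cube := by
    calc px 1 * px 1 * px 1 = ps 1 * (pa 1 * ps 1) * (pa 1 * ps 1) * pa 1 := by
          simp only [px, mul_assoc]
      _ = ps 1 * ps 0 * (pa 0 * ps 0) * pa 0 * pa 1 := by
          simp only [pa_one_mul_ps_one, mul_assoc]
      _ = 0 := by simp [pa_zero_mul_ps_zero]
  mid_cube := by
    calc px 2 * px 2 * px 2 = ps 2 * (pa 2 * ps 2) * (pa 2 * ps 2) * pa 2 := by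
          simp only [px, mul_assoc]
      _ = ps 2 * ps 3 * (pa 3 * ps 3) * pa 3 * pa 2 := by
          simp only [pa_two_mul_ps_two, mul_assoc]
      _ = 0 := by simp [pa_three_mul_ps_three]
  right_sq := by
    rw [px, mul_assoc, ← mul_assoc (pa 4), pa_four_mul_ps_four, zero_mul, mul_zero]

theorem pa_one_mul_px_sq : pa 1 * px 1 * px 1 = 0 := by
  calc pa 1 * px 1 * px 1 = (pa 1 * ps 1) * (pa 1 * ps 1) * pa 1 := by simp only [px, mul_assoc]
    _ = ps 0 * (pa 0 * ps 0) * pa 0 * pa 1 := by simp only [pa_one_mul_ps_one, mul_assoc]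
    _ = 0 := by simp [pa_zero_mul_ps_zero]

theorem px_sq_mul_ps_one : px 1 * px 1 * ps 1 = 0 := by
  calc px 1 * px 1 * ps 1 = ps 1 * ((pa 1 * ps 1) * (pa 1 * ps 1)) := by simp only [px, mul_assoc]
    _ = ps 1 * ps 0 * (pa 0 * ps 0) * pa 0 := by simp only [pa_one_mul_ps_one, mul_assoc]
    _ = 0 := by simp [pa_zero_mul_ps_zero]

theorem pa_two_mul_px_sq : pa 2 * px 2 * px 2 = 0 := by
  calc pa 2 * px 2 * px 2 = (pa 2 * ps 2) * (pa 2 * ps 2) * pa 2 := by simp only [px, mul_assoc]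
    _ = ps 3 * (pa 3 * ps 3) * pa 3 * pa 2 := by simp only [pa_two_mul_ps_two, mul_assoc]
    _ = 0 := by simp [pa_three_mul_ps_three]

theorem px_sq_mul_ps_two : px 2 * px 2 * ps 2 = 0 := by
  calc px 2 * px 2 * ps 2 = ps 2 * ((pa 2 * ps 2) * (pa 2 * ps 2)) := by simp only [px, mul_assoc]
    _ = ps 2 * ps 3 * (pa 3 * ps 3) * pa 3 := by simp only [pa_two_mul_ps_two, mul_assoc]
    _ = 0 := by simp [pa_three_mul_ps_three]

theorem pa_zero_mul_pa_one_mul_px : pa 0 * pa 1 * px 1 = 0 := by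
  rw [px, mul_assoc, ← mul_assoc (pa 1), pa_one_mul_ps_one, ← mul_assoc, ← mul_assoc,
    pa_zero_mul_ps_zero, zero_mul, zero_mul]

theorem px_mul_ps_one_mul_ps_zero : px 1 * (ps 1 * ps 0) = 0 := by
  rw [px, mul_assoc, ← mul_assoc (pa 1), pa_one_mul_ps_one, mul_assoc, pa_zero_mul_ps_zero,
    mul_zero, mul_zero]

theorem pa_three_mul_pa_two_mul_px : pa 3 * pa 2 * px 2 = 0 := by
  rw [px, mul_assoc, ← mul_assoc (pa 2), pa_two_mul_ps_two, ← mul_assoc, ← mul_assoc,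
    pa_three_mul_ps_three, zero_mul, zero_mul]

theorem px_mul_ps_two_mul_ps_three : px 2 * (ps 2 * ps 3) = 0 := by
  rw [px, mul_assoc, ← mul_assoc (pa 2), pa_two_mul_ps_two, mul_assoc, pa_three_mul_ps_three,
    mul_zero, mul_zero]

theorem ps_mul_ps_mul_pa_mul_pa_one : ps 1 * ps 0 * (pa 0 * pa 1) = px 1 * px 1 := by
  calc ps 1 * ps 0 * (pa 0 * pa 1) = ps 1 * (ps 0 * pa 0) * pa 1 := by simp only [mul_assoc]
    _ = px 1 * px 1 := by rw [← pa_one_mul_ps_one]; simp only [px, mul_assoc]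

theorem ps_mul_ps_mul_pa_mul_pa_two : ps 2 * ps 3 * (pa 3 * pa 2) = px 2 * px 2 := by
  calc ps 2 * ps 3 * (pa 3 * pa 2) = ps 2 * (ps 3 * pa 3) * pa 2 := by simp only [mul_assoc]
    _ = px 2 * px 2 := by rw [← pa_two_mul_ps_two]; simp only [px, mul_assoc]

/-- The component of `z₆` at each vertex. -/
noncomputable def z6Component : Fin 6 → PiE6 :=
  ![pa 0 * pa 1 * px 2 * (ps 1 * ps 0), -(pa 1 * (px 2 * px 2) * ps 1), -(px 4 * px 2 * px 4),
    pa 2 * (px 1 * px 1) * ps 2, -(pa 3 * pa 2 * px 1 * (ps 2 * ps 3)), 0]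

/-- The component of `z₈` at each vertex. -/
noncomputable def z8Component : Fin 6 → PiE6 :=
  ![0, -(pa 1 * (px 4 * px 2 * px 4) * ps 1), -(px 4 * (px 2 * px 2) * px 4),
    -(pa 2 * (px 4 * px 1 * px 4) * ps 2), 0, 0]

theorem z6_eq_sum : z6 = ∑ i, z6Component i := by
  simp only [Fin.sum_univ_six, z6Component, z6, Matrix.cons_val]
  noncomm_ring

theorem z8_eq_sum : z8 = ∑ i, z8Component i := by
  simp only [Fin.sum_univ_six, z8Component, z8, Matrix.cons_val]
  noncomm_ring

theorem idem_mul_z6Component (i : Fin 6) : idem i * z6Component i = z6Component i := by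
  fin_cases i <;>
    simp [z6Component, px, PiE6.mul_neg, ← mul_assoc, idem_mul_pa_eq_ite, idem_mul_ps_eq_ite,
      E6.src, E6.tgt]

theorem idem_mul_z8Component (i : Fin 6) : idem i * z8Component i = z8Component i := by
  fin_cases i <;>
    simp [z8Component, px, PiE6.mul_neg, ← mul_assoc, idem_mul_pa_eq_ite, idem_mul_ps_eq_ite,
      E6.src, E6.tgt]

theorem z6Component_mul_idem (i : Fin 6) : z6Component i * idem i = z6Component i := by
  have h0 : ps 0 * idem 0 = ps 0 := ps_mul_idem 0
  have h1 : ps 1 * idem 1 = ps 1 := ps_mul_idem 1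
  have h2 : pa 4 * idem 2 = pa 4 := pa_mul_idem 4
  have h3 : ps 2 * idem 3 = ps 2 := ps_mul_idem 2
  have h4 : ps 3 * idem 4 = ps 3 := ps_mul_idem 3
  fin_cases i <;> simp [z6Component, px, PiE6.neg_mul, mul_assoc, h0, h1, h2, h3, h4]

theorem z8Component_mul_idem (i : Fin 6) : z8Component i * idem i = z8Component i := by
  have h1 : ps 1 * idem 1 = ps 1 := ps_mul_idem 1
  have h2 : pa 4 * idem 2 = pa 4 := pa_mul_idem 4
  have h3 : ps 2 * idem 3 = ps 2 := ps_mul_idem 2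
  fin_cases i <;> simp [z8Component, px, PiE6.neg_mul, mul_assoc, h1, h2, h3]

theorem sandwich_mul_sandwich {R : Type*} [Semigroup R] (p q u v : R) :
    p * u * q * (p * v * q) = p * (u * (q * p) * v) * q := by
  simp only [mul_assoc]

theorem px_four_mul_px_four_sandwich (u v : PiE6) :
    px 4 * u * px 4 * (px 4 * v * px 4) = 0 := by
  rw [sandwich_mul_sandwich, trivalentRel_px.right_sq, mul_zero, zero_mul, mul_zero, zero_mul]

theorem z6Component_mul_self (i : Fin 6) : z6Component i * z6Component i = 0 := by
  have h := trivalentRel_px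
  fin_cases i <;> simp only [z6Component, Fin.mk_one, Fin.zero_eta, Fin.reduceFinMk,
    Matrix.cons_val, PiE6.neg_mul, PiE6.mul_neg, neg_neg, mul_zero]
  · rw [sandwich_mul_sandwich, ps_mul_ps_mul_pa_mul_pa_one, ← mul_assoc (px 2)]
    exact h.mul_yxxy_mul pa_zero_mul_pa_one_mul_px px_mul_ps_one_mul_ps_zero
  · rw [sandwich_mul_sandwich]
    simpa only [px, mul_assoc] using h.mul_yyxyy_mul pa_one_mul_px_sq px_sq_mul_ps_one
  · exact px_four_mul_px_four_sandwich _ _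
  · rw [sandwich_mul_sandwich]
    simpa only [px, mul_assoc] using h.swap.mul_yyxyy_mul pa_two_mul_px_sq px_sq_mul_ps_two
  · rw [sandwich_mul_sandwich, ps_mul_ps_mul_pa_mul_pa_two, ← mul_assoc (px 1)]
    exact h.swap.mul_yxxy_mul pa_three_mul_pa_two_mul_px px_mul_ps_two_mul_ps_three

theorem z6Component_mul_z8Component (i : Fin 6) : z6Component i * z8Component i = 0 := by
  have h := trivalentRel_px
  fin_cases i <;> simp only [z6Component, z8Component, Fin.mk_one, Fin.zero_eta, Fin.reduceFinMk,
    Matrix.cons_val, PiE6.neg_mul, PiE6.mul_neg, neg_neg, mul_zero]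
  · rw [sandwich_mul_sandwich, ← px, h.yyxzyz, mul_zero, zero_mul]
  · exact px_four_mul_px_four_sandwich _ _
  · rw [sandwich_mul_sandwich, ← px, h.swap.yyxzyz, mul_zero, zero_mul, neg_zero]

theorem z8Component_mul_self (i : Fin 6) : z8Component i * z8Component i = 0 := by
  have h := trivalentRel_px
  fin_cases i <;> simp only [z8Component, Fin.mk_one, Fin.zero_eta, Fin.reduceFinMk,
    Matrix.cons_val, PiE6.neg_mul, PiE6.mul_neg, neg_neg, mul_zero]
  · rw [sandwich_mul_sandwich, ← px, h.zyzxzyz, mul_zero, zero_mul]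
  · exact px_four_mul_px_four_sandwich _ _
  · rw [sandwich_mul_sandwich, ← px, h.swap.zyzxzyz, mul_zero, zero_mul]

end PiE6

open PiE6 in
/-- All products of the positive-degree central elements `z₆`, `z₈` of `Π(E₆)` vanish. -/
theorem z6_z8_products_vanish : z6 ^ 2 = 0 ∧ z6 * z8 = 0 ∧ z8 ^ 2 = 0 := by
  have he (i j : Fin 6) (hij : i ≠ j) : idem i * idem j = 0 := by rw [idem_mul_idem, if_neg hij]
  rw [sq, sq, z6_eq_sum, z8_eq_sum]
  exact ⟨
    sum_mul_sum_eq_zero_of_orthogonal he z6Component_mul_idem idem_mul_z6Component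
      z6Component_mul_self,
    sum_mul_sum_eq_zero_of_orthogonal he z6Component_mul_idem idem_mul_z8Component
      z6Component_mul_z8Component,
    sum_mul_sum_eq_zero_of_orthogonal he z8Component_mul_idem idem_mul_z8Component
      z8Component_mul_self⟩
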